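/- (Generalized Stein's Lemma for convex Lipschitz functions) Let g : ℝ^d → ℝ be convex and Lipschitz continuous on ℝ^d, let μ ∈ ℝ^d, let Σ be a d×d positive definite matrix, and let X ~ N(μ, Σ). Let H : ℝ^d → (d×d symmetric matrices) be measurable and such that for Lebesgue-almost every x ∈ ℝ^d, g is differentiable on a neighborhood-free full-measure set and the gradient map ∇g is differentiable at x with total derivative H(x). Then for every u ∈ ℝ^d, E[uᵀH(X)u] ≤ uᵀ E[g(X)·(Σ⁻¹(X−μ)(X−μ)ᵀΣ⁻¹ − Σ⁻¹)] u, where the left-hand integrand is almost everywhere nonnegative (so its expectation is well-defined in [0,∞]) and the right-hand expectation exists entrywise since g is Lipschitz; i.e., E[H(X)] ⪯ E[g(X)·(Σ⁻¹(X−μ)(X−μ)ᵀΣ⁻¹ − Σ⁻¹)] in the positive semidefinite order. -/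

import Mathlib

open MeasureTheory Matrix

/-- The density of the Gaussian distribution `N(μ, Σ)` on `ℝ^d` (for `Σ` positive
definite) with respect to Lebesgue measure. -/
noncomputable def gaussPdf (d : ℕ) (μ : Fin d → ℝ) (S : Matrix (Fin d) (Fin d) ℝ)
    (x : Fin d → ℝ) : ℝ :=
  (2 * Real.pi) ^ (-(d : ℝ) / 2) * Real.sqrt S.det⁻¹ *
    Real.exp (-(1 / 2) * ((x - μ) ⬝ᵥ S⁻¹.mulVec (x - μ)))

open Filter Topology

/-- Gaussian domination. -/
def GaussBdd (d : ℕ) (F : (Fin d → ℝ) → ℝ) : Prop :=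
  ∃ K c : ℝ, 0 < c ∧ 0 ≤ K ∧ ∀ x, |F x| ≤ K * Real.exp (-c * ‖x‖ ^ 2)

lemma integrable_exp_norm_sq (d : ℕ) (b : ℝ) (hb : 0 < b) :
    Integrable (fun x : Fin d → ℝ => Real.exp (-b * ‖x‖ ^ 2)) := by
  have hb' : 0 < b / (d + 1) := by positivity
  have h1 : Integrable (fun x : Fin d → ℝ => ∏ i, Real.exp (-(b / (d + 1)) * (x i) ^ 2)) :=
    Integrable.fintype_prod (f := fun _ t => Real.exp (-(b / (d + 1)) * t ^ 2))
      (fun _ => integrable_exp_neg_mul_sq hb')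
  refine h1.mono' (by fun_prop) (Eventually.of_forall fun x => ?_)
  rw [Real.norm_eq_abs, abs_of_pos (Real.exp_pos _), ← Real.exp_sum, Real.exp_le_exp,
    ← Finset.mul_sum]
  have h2 : ∑ i, (x i) ^ 2 ≤ (d + 1) * ‖x‖ ^ 2 := by
    calc ∑ i, (x i) ^ 2 ≤ ∑ i : Fin d, ‖x‖ ^ 2 := by
          refine Finset.sum_le_sum fun i _ => ?_
          rw [← sq_abs]
          have := norm_le_pi_norm x i
          rw [Real.norm_eq_abs] at this
          gcongr
      _ = d * ‖x‖ ^ 2 := by simp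
      _ ≤ _ := by nlinarith [sq_nonneg ‖x‖]
  have h3 : b / (d + 1) * ∑ i, (x i) ^ 2 ≤ b / (d + 1) * ((d + 1) * ‖x‖ ^ 2) := by gcongr
  have h4 : b / (d + 1) * ((d + 1) * ‖x‖ ^ 2) = b * ‖x‖ ^ 2 := by field_simp
  linarith

lemma poly_exp_bound (c t : ℝ) (hc : 0 < c) :
    (1 + t) ^ 2 * Real.exp (-c * t ^ 2) ≤ (2 + 4 / c) * Real.exp (-(c / 2) * t ^ 2) := by
  have h1 : (1 + t) ^ 2 ≤ (2 + 4 / c) * Real.exp (c / 2 * t ^ 2) := by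
    have h2 := Real.add_one_le_exp (c / 2 * t ^ 2)
    have h3 : (2 + 4 / c) * (c / 2 * t ^ 2 + 1) ≤ (2 + 4 / c) * Real.exp (c / 2 * t ^ 2) := by
      gcongr
    have h4 : (2 + 4 / c) * (c / 2 * t ^ 2 + 1) = c * t ^ 2 + 2 + 2 * t ^ 2 + 4 / c := by
      field_simp; ring
    have : 0 < 4 / c := by positivity
    have : 0 ≤ c * t ^ 2 := by positivity
    nlinarith [sq_nonneg (1 - t)]
  calc _ ≤ (2 + 4 / c) * Real.exp (c / 2 * t ^ 2) * Real.exp (-c * t ^ 2) := by gcongr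
    _ = _ := by rw [mul_assoc, ← Real.exp_add]; ring_nf

lemma GaussBdd.of_poly {d : ℕ} {F : (Fin d → ℝ) → ℝ} (K c : ℝ) (hc : 0 < c) (hK : 0 ≤ K)
    (h : ∀ x, |F x| ≤ K * ((1 + ‖x‖) ^ 2 * Real.exp (-c * ‖x‖ ^ 2))) : GaussBdd d F := by
  refine ⟨K * (2 + 4 / c), c / 2, by positivity, by positivity, fun x => (h x).trans ?_⟩
  rw [mul_assoc]
  exact mul_le_mul_of_nonneg_left (poly_exp_bound c _ hc) hK

lemma exp_shift {d : ℕ} (c R : ℝ) (hc : 0 < c) (x w : Fin d → ℝ) (hw : ‖w‖ ≤ R) :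
    Real.exp (-c * ‖x + w‖ ^ 2) ≤ Real.exp (c * R ^ 2) * Real.exp (-(c / 2) * ‖x‖ ^ 2) := by
  rw [← Real.exp_add, Real.exp_le_exp]
  have h1 : ‖x‖ ≤ ‖x + w‖ + ‖w‖ := by
    have := norm_sub_le (x + w) w
    simpa using this
  have h2 : ‖x‖ ^ 2 ≤ 2 * ‖x + w‖ ^ 2 + 2 * R ^ 2 := by
    have h0 : ‖x‖ ≤ ‖x + w‖ + R := by linarith
    have : ‖x‖ ^ 2 ≤ (‖x + w‖ + R) ^ 2 := by gcongr
    nlinarith [sq_nonneg (‖x + w‖ - R)]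
  nlinarith

lemma GaussBdd.dom {d : ℕ} {F : (Fin d → ℝ) → ℝ} (hF : GaussBdd d F) (C R : ℝ) (hC : 0 ≤ C) :
    ∃ G : (Fin d → ℝ) → ℝ, Integrable G ∧
      ∀ x w, ‖w‖ ≤ R → C * (1 + ‖x‖) * |F (x + w)| ≤ G x := by
  obtain ⟨K, c, hc, hK, h⟩ := hF
  refine ⟨fun x => C * K * Real.exp (c * R ^ 2) * (2 + 4 / (c / 2)) *
    Real.exp (-(c / 2 / 2) * ‖x‖ ^ 2), (integrable_exp_norm_sq d _ (by positivity)).const_mul _,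
    fun x w hw => ?_⟩
  have h1 := poly_exp_bound (c / 2) ‖x‖ (by positivity)
  have h2 : 1 + ‖x‖ ≤ (1 + ‖x‖) ^ 2 := by nlinarith [norm_nonneg x]
  calc C * (1 + ‖x‖) * |F (x + w)|
      ≤ C * (1 + ‖x‖) ^ 2 * (K * (Real.exp (c * R ^ 2) * Real.exp (-(c / 2) * ‖x‖ ^ 2))) := by
        gcongr
        refine (h _).trans ?_
        gcongr
        exact exp_shift c R hc x w hw
    _ = C * K * Real.exp (c * R ^ 2) * ((1 + ‖x‖) ^ 2 * Real.exp (-(c / 2) * ‖x‖ ^ 2)) := by ring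
    _ ≤ C * K * Real.exp (c * R ^ 2) *
        ((2 + 4 / (c / 2)) * Real.exp (-(c / 2 / 2) * ‖x‖ ^ 2)) := by gcongr
    _ = _ := by ring

lemma GaussBdd.integrable_mul {d : ℕ} {F f : (Fin d → ℝ) → ℝ} (hF : GaussBdd d F)
    (hFc : Continuous F) (hf : Measurable f) (C : ℝ) (hC : 0 ≤ C)
    (hfb : ∀ x, |f x| ≤ C * (1 + ‖x‖)) (w : Fin d → ℝ) :
    Integrable (fun x => f x * F (x + w)) := by
  obtain ⟨G, hG, h⟩ := hF.dom C ‖w‖ hC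
  have hm : Measurable (fun x => F (x + w)) := (by fun_prop : Continuous _).measurable
  refine hG.mono' (hf.mul hm).aestronglyMeasurable
    (Eventually.of_forall fun x => ?_)
  rw [norm_mul, Real.norm_eq_abs, Real.norm_eq_abs]
  refine le_trans ?_ (h x w le_rfl)
  gcongr
  exact hfb x

lemma tendsto_quot {d : ℕ} {ψ ψ' f : (Fin d → ℝ) → ℝ} {v : Fin d → ℝ} (hψ' : GaussBdd d ψ')
    (hψc : Continuous ψ) (hd : ∀ x, HasLineDerivAt ℝ ψ (ψ' x) x v)
    (hf : Measurable f) (C : ℝ) (hC : 0 ≤ C) (hfb : ∀ x, |f x| ≤ C * (1 + ‖x‖)) :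
    Tendsto (fun t : ℝ => ∫ x, f x * (t⁻¹ * (ψ (x + t • v) - ψ x))) (𝓝[>] 0)
      (𝓝 (∫ x, f x * ψ' x)) := by
  obtain ⟨G, hG, h⟩ := hψ'.dom C ‖v‖ hC
  refine tendsto_integral_filter_of_dominated_convergence G ?_ ?_ hG ?_
  · filter_upwards with t
    have hm : Measurable (fun x => t⁻¹ * (ψ (x + t • v) - ψ x)) :=
      (by fun_prop : Continuous _).measurable
    exact (hf.mul hm).aestronglyMeasurable
  · filter_upwards [Ioc_mem_nhdsGT (zero_lt_one : (0:ℝ) < 1)] with t ht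
    filter_upwards with x
    have hder : ∀ s : ℝ, HasDerivAt (fun s : ℝ => ψ (x + s • v)) (ψ' (x + s • v)) s := by
      intro s
      have h1 := hd (x + s • v)
      unfold HasLineDerivAt at h1
      have h2 : HasDerivAt (fun r : ℝ => r - s) 1 s := (hasDerivAt_id s).sub_const s
      have h3 := HasDerivAt.comp s (h₂ := fun t : ℝ => ψ (x + s • v + t • v))
        (h := fun r : ℝ => r - s) (by simpa using h1) h2
      rw [mul_one] at h3
      refine h3.congr_of_eventuallyEq (Eventually.of_forall fun r => ?_)
      simp only [Function.comp]
      congr 1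
      rw [add_assoc, ← add_smul]; simp
    obtain ⟨ξ, hξ, he⟩ := exists_hasDerivAt_eq_slope (fun s : ℝ => ψ (x + s • v))
      (fun s => ψ' (x + s • v)) ht.1
      (fun s _ => (hder s).continuousAt.continuousWithinAt) (fun s _ => hder s)
    have he' : t⁻¹ * (ψ (x + t • v) - ψ x) = ψ' (x + ξ • v) := by
      rw [he]; simp [div_eq_inv_mul]
    rw [he', norm_mul, Real.norm_eq_abs, Real.norm_eq_abs]
    refine le_trans ?_ (h x (ξ • v) ?_)
    · gcongr; exact hfb x
    · rw [norm_smul, Real.norm_eq_abs, abs_of_pos hξ.1]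
      have : ξ ≤ 1 := hξ.2.le.trans ht.2
      nlinarith [norm_nonneg v]
  · filter_upwards with x
    exact tendsto_const_nhds.mul (hd x).tendsto_slope_zero_right

lemma transl_quot {d : ℕ} {ψ f : (Fin d → ℝ) → ℝ} {u : Fin d → ℝ} (hψ : GaussBdd d ψ)
    (hψc : Continuous ψ)
    (hf : Measurable f) (C : ℝ) (hC : 0 ≤ C) (hfb : ∀ x, |f x| ≤ C * (1 + ‖x‖)) (t : ℝ) :
    Integrable (fun x => (t⁻¹ * (f (x + t • u) - f x)) * ψ x) ∧
    ∫ x, (t⁻¹ * (f (x + t • u) - f x)) * ψ x =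
      ∫ x, f x * (t⁻¹ * (ψ (x + t • (-u)) - ψ x)) := by
  have i1 : Integrable (fun x => f x * ψ (x + t • (-u))) :=
    hψ.integrable_mul hψc hf C hC hfb _
  have i2 : Integrable (fun x => f x * ψ x) := by
    simpa using hψ.integrable_mul hψc hf C hC hfb 0
  have i3 : Integrable (fun x => f (x + t • u) * ψ x) := by
    have := i1.comp_add_right (t • u)
    simpa using this
  have S3 : ∫ x, f (x + t • u) * ψ x = ∫ x, f x * ψ (x + t • (-u)) := by
    rw [← integral_add_right_eq_self _ (t • (-u))]; simp
  have e1 : (fun x => (t⁻¹ * (f (x + t • u) - f x)) * ψ x) =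
      fun x => t⁻¹ * (f (x + t • u) * ψ x - f x * ψ x) := by ext x; ring
  have e2 : (fun x => f x * (t⁻¹ * (ψ (x + t • (-u)) - ψ x))) =
      fun x => t⁻¹ * (f x * ψ (x + t • (-u)) - f x * ψ x) := by ext x; ring
  rw [e1, e2]
  refine ⟨(i3.sub i2).const_mul _, ?_⟩
  rw [integral_const_mul, integral_const_mul, integral_sub i3 i2, integral_sub i1 i2, S3]

lemma quad_lower {d : ℕ} (A : Matrix (Fin d) (Fin d) ℝ) (hA : A.PosDef) :
    ∃ c : ℝ, 0 < c ∧ ∀ y : Fin d → ℝ, c * ‖y‖ ^ 2 ≤ y ⬝ᵥ A.mulVec y := by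
  have hpos : ∀ y : Fin d → ℝ, y ≠ 0 → 0 < y ⬝ᵥ A.mulVec y := fun y hy => by
    simpa using hA.dotProduct_mulVec_pos hy
  have hcont : Continuous (fun y : Fin d → ℝ => y ⬝ᵥ A.mulVec y) := by fun_prop
  have key : ∃ c : ℝ, 0 < c ∧ ∀ y ∈ Metric.sphere (0 : Fin d → ℝ) 1, c ≤ y ⬝ᵥ A.mulVec y := by
    rcases (Metric.sphere (0 : Fin d → ℝ) 1).eq_empty_or_nonempty with h | h
    · exact ⟨1, one_pos, by simp [h]⟩
    · obtain ⟨y, hy, hm⟩ := (isCompact_sphere (0 : Fin d → ℝ) 1).exists_isMinOn h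
        hcont.continuousOn
      refine ⟨_, hpos y ?_, fun z hz => hm hz⟩
      rintro rfl
      simp at hy
  obtain ⟨c, hc, h⟩ := key
  refine ⟨c, hc, fun y => ?_⟩
  by_cases hy : y = 0
  · simp [hy]
  have hn : 0 < ‖y‖ := norm_pos_iff.2 hy
  have h1 := h (‖y‖⁻¹ • y) (by simp [norm_smul, hn.ne'])
  rw [mulVec_smul, smul_dotProduct, dotProduct_smul, smul_eq_mul, smul_eq_mul] at h1
  calc c * ‖y‖ ^ 2 ≤ (‖y‖⁻¹ * (‖y‖⁻¹ * (y ⬝ᵥ A.mulVec y))) * ‖y‖ ^ 2 := by gcongr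
    _ = _ := by field_simp

lemma lin_bound {d : ℕ} (u : Fin d → ℝ) (A : Matrix (Fin d) (Fin d) ℝ) :
    ∃ M : ℝ, 0 ≤ M ∧ ∀ y : Fin d → ℝ, |u ⬝ᵥ A.mulVec y| ≤ M * ‖y‖ := by
  let l : (Fin d → ℝ) →ₗ[ℝ] ℝ :=
    { toFun := fun y => u ⬝ᵥ A.mulVec y
      map_add' := fun x y => by simp [mulVec_add]
      map_smul' := fun x y => by simp [mulVec_smul] }
  exact ⟨‖LinearMap.toContinuousLinearMap l‖, norm_nonneg _,
    fun y => (LinearMap.toContinuousLinearMap l).le_opNorm y⟩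

lemma gauss_deriv (d : ℕ) (μ : Fin d → ℝ) (S : Matrix (Fin d) (Fin d) ℝ) (hS : S.PosDef)
    (v x : Fin d → ℝ) :
    HasLineDerivAt ℝ (gaussPdf d μ S) (-(v ⬝ᵥ S⁻¹.mulVec (x - μ)) * gaussPdf d μ S x) x v := by
  have hsym : ∀ a b : Fin d → ℝ, a ⬝ᵥ S⁻¹.mulVec b = b ⬝ᵥ S⁻¹.mulVec a := by
    intro a b
    have h1 : (S⁻¹)ᵀ = S⁻¹ := by
      have := hS.inv.isHermitian.eq
      rwa [conjTranspose_eq_transpose_of_trivial] at this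
    rw [dotProduct_mulVec, ← mulVec_transpose, h1, dotProduct_comm]
  have hq : HasDerivAt (fun t : ℝ => (x - μ) ⬝ᵥ S⁻¹.mulVec (x - μ) +
      2 * (v ⬝ᵥ S⁻¹.mulVec (x - μ)) * t + (v ⬝ᵥ S⁻¹.mulVec v) * t ^ 2)
      (2 * (v ⬝ᵥ S⁻¹.mulVec (x - μ))) 0 := by
    have h1 := ((hasDerivAt_id (0:ℝ)).const_mul (2 * (v ⬝ᵥ S⁻¹.mulVec (x - μ)))).const_add
      ((x - μ) ⬝ᵥ S⁻¹.mulVec (x - μ))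
    have h2 := ((hasDerivAt_id (0:ℝ)).pow 2).const_mul (v ⬝ᵥ S⁻¹.mulVec v)
    have h3 := h1.add h2
    simp only [id, mul_one, Nat.cast_ofNat] at h3
    convert! h3 using 1
    simp
  have he := ((hq.const_mul (-(1/2) : ℝ)).exp).const_mul
    ((2 * Real.pi) ^ (-(d : ℝ) / 2) * Real.sqrt S.det⁻¹)
  unfold HasLineDerivAt
  convert! he using 1
  · ext t
    unfold gaussPdf
    congr 2
    have : x + t • v - μ = (x - μ) + t • v := by abel
    rw [this, mulVec_add, dotProduct_add, add_dotProduct, add_dotProduct, mulVec_smul,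
      smul_dotProduct, smul_dotProduct, dotProduct_smul, dotProduct_smul, hsym (x - μ) v]
    simp only [smul_eq_mul]
    ring
  · unfold gaussPdf
    simp only [mul_zero, add_zero]
    ring_nf

lemma gauss_deriv2 (d : ℕ) (μ : Fin d → ℝ) (S : Matrix (Fin d) (Fin d) ℝ) (hS : S.PosDef)
    (u v x : Fin d → ℝ) :
    HasLineDerivAt ℝ (fun x => -(u ⬝ᵥ S⁻¹.mulVec (x - μ)) * gaussPdf d μ S x)
      ((-(u ⬝ᵥ S⁻¹.mulVec v) + (u ⬝ᵥ S⁻¹.mulVec (x - μ)) * (v ⬝ᵥ S⁻¹.mulVec (x - μ)))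
        * gaussPdf d μ S x) x v := by
  have h1 := gauss_deriv d μ S hS v x
  unfold HasLineDerivAt at h1 ⊢
  have h2 : HasDerivAt (fun t : ℝ => -(u ⬝ᵥ S⁻¹.mulVec (x + t • v - μ)))
      (-(u ⬝ᵥ S⁻¹.mulVec v)) 0 := by
    have h3 := (((hasDerivAt_id (0:ℝ)).mul_const (u ⬝ᵥ S⁻¹.mulVec v)).const_add
      (u ⬝ᵥ S⁻¹.mulVec (x - μ))).neg
    convert! h3 using 1
    · ext t
      have : x + t • v - μ = (x - μ) + t • v := by abel
      simp [this, mulVec_add, mulVec_smul]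
    · simp
  have h4 := h2.mul h1
  convert! h4 using 1
  simp
  ring

lemma gauss_cont (d : ℕ) (μ : Fin d → ℝ) (S : Matrix (Fin d) (Fin d) ℝ) :
    Continuous (gaussPdf d μ S) := by
  unfold gaussPdf
  fun_prop

lemma gauss_nonneg (d : ℕ) (μ : Fin d → ℝ) (S : Matrix (Fin d) (Fin d) ℝ) (x : Fin d → ℝ) :
    0 ≤ gaussPdf d μ S x := by
  unfold gaussPdf
  have := Real.pi_pos
  positivity

lemma gauss_poly_bdd (d : ℕ) (μ : Fin d → ℝ) (S : Matrix (Fin d) (Fin d) ℝ) (hS : S.PosDef)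
    (P : (Fin d → ℝ) → ℝ) (M : ℝ) (hM : 0 ≤ M) (hP : ∀ x, |P x| ≤ M * (1 + ‖x‖) ^ 2) :
    GaussBdd d (fun x => P x * gaussPdf d μ S x) := by
  obtain ⟨c, hc, h⟩ := quad_lower S⁻¹ hS.inv
  have hpi := Real.pi_pos
  refine GaussBdd.of_poly (M * ((2 * Real.pi) ^ (-(d : ℝ) / 2) * Real.sqrt S.det⁻¹ *
    Real.exp (c / 2 * ‖μ‖ ^ 2))) (c / 2 / 2) (by positivity) (by positivity) fun x => ?_
  rw [abs_mul, abs_of_nonneg (gauss_nonneg d μ S x)]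
  have h1 : gaussPdf d μ S x ≤ (2 * Real.pi) ^ (-(d : ℝ) / 2) * Real.sqrt S.det⁻¹ *
      (Real.exp (c / 2 * ‖μ‖ ^ 2) * Real.exp (-(c / 2 / 2) * ‖x‖ ^ 2)) := by
    unfold gaussPdf
    gcongr
    refine le_trans ?_ (exp_shift (c / 2) ‖μ‖ (by positivity) x (-μ) (by simp))
    rw [Real.exp_le_exp, ← sub_eq_add_neg]
    have := h (x - μ)
    linarith
  calc |P x| * gaussPdf d μ S x ≤ (M * (1 + ‖x‖) ^ 2) * _ :=
        mul_le_mul (hP x) h1 (gauss_nonneg _ _ _ _) (by positivity)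
    _ = _ := by ring

lemma mono_quot {d : ℕ} {g : (Fin d → ℝ) → ℝ} (hconv : ConvexOn ℝ Set.univ g)
    (x u : Fin d → ℝ) (t : ℝ) (ht : 0 < t) (h1 : LineDifferentiableAt ℝ g x u)
    (h2 : LineDifferentiableAt ℝ g (x + t • u) u) :
    lineDeriv ℝ g x u ≤ lineDeriv ℝ g (x + t • u) u := by
  have hc : ConvexOn ℝ Set.univ (fun s : ℝ => g (x + s • u)) := by
    have := hconv.comp_affineMap (AffineMap.lineMap x (x + u) : ℝ →ᵃ[ℝ] (Fin d → ℝ))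
    simp only [Set.preimage_univ] at this
    refine this.congr fun s _ => ?_
    simp [AffineMap.lineMap_apply, add_comm]
  have d1 : HasDerivAt (fun s : ℝ => g (x + s • u)) (lineDeriv ℝ g x u) 0 := h1.hasLineDerivAt
  have d2 : HasDerivAt (fun s : ℝ => g (x + s • u)) (lineDeriv ℝ g (x + t • u) u) t := by
    have h3 := h2.hasLineDerivAt
    unfold HasLineDerivAt at h3
    have h4 : HasDerivAt (fun r : ℝ => r - t) 1 t := (hasDerivAt_id t).sub_const t
    have h5 := HasDerivAt.comp t (h₂ := fun s : ℝ => g (x + t • u + s • u))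
        (h := fun r : ℝ => r - t) (by simpa using h3) h4
    rw [mul_one] at h5
    refine h5.congr_of_eventuallyEq (Eventually.of_forall fun r => ?_)
    simp only [Function.comp]
    congr 1
    rw [add_assoc, ← add_smul]; simp
  exact (hc.le_slope_of_hasDerivAt trivial trivial ht d1).trans
    (hc.slope_le_of_hasDerivAt trivial trivial ht d2)

/-- Generalized Stein's lemma: for `g : ℝ^d → ℝ` convex and Lipschitz, `X ~ N(μ, Σ)`
with `Σ` positive definite, and `H` a measurable symmetric-matrix-valued map that is
Lebesgue-a.e. the second (Alexandrov) derivative of `g`, we have for every `u`,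
`E[uᵀ H(X) u] ≤ uᵀ E[g(X)(Σ⁻¹(X−μ)(X−μ)ᵀΣ⁻¹ − Σ⁻¹)] u`, the left side being a
well-defined element of `[0,∞]` (the integrand is a.e. nonnegative). -/
theorem stmt_8 (d : ℕ) (g : (Fin d → ℝ) → ℝ)
    (hconv : ConvexOn ℝ Set.univ g) (hlip : ∃ L : NNReal, LipschitzWith L g)
    (μ : Fin d → ℝ) (S : Matrix (Fin d) (Fin d) ℝ) (hS : S.PosDef)
    (H : (Fin d → ℝ) → Matrix (Fin d) (Fin d) ℝ)
    (hHmeas : ∀ i j, Measurable fun x => H x i j)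
    (hHsymm : ∀ x, (H x).IsSymm)
    (hH : ∀ᵐ x ∂(volume : Measure (Fin d → ℝ)),
      ∃ D : (Fin d → ℝ) →L[ℝ] (Fin d → ℝ) →L[ℝ] ℝ,
        HasFDerivAt (fderiv ℝ g) D x ∧ ∀ u v, D u v = u ⬝ᵥ (H x).mulVec v) :
    ∀ u : Fin d → ℝ,
      (∫⁻ x, ENNReal.ofReal ((u ⬝ᵥ (H x).mulVec u) * gaussPdf d μ S x)) ≤
        ENNReal.ofReal (∫ x,
          g x * ((u ⬝ᵥ S⁻¹.mulVec (x - μ)) ^ 2 - u ⬝ᵥ S⁻¹.mulVec u) *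
            gaussPdf d μ S x) := by
  intro u
  obtain ⟨L, hL⟩ := hlip
  have hgm : Measurable g := hL.continuous.measurable
  -- growth bounds
  have hgb : ∀ x, |g x| ≤ (|g 0| + L) * (1 + ‖x‖) := by
    intro x
    have h1 := hL.norm_sub_le x 0
    rw [sub_zero, Real.norm_eq_abs] at h1
    have h2 : |g x| ≤ |g x - g 0| + |g 0| := by
      have := abs_add_le (g x - g 0) (g 0)
      simpa using this
    have h3 : (0:ℝ) ≤ L := L.2
    nlinarith [norm_nonneg x, abs_nonneg (g 0), mul_nonneg (abs_nonneg (g 0)) (norm_nonneg x)]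
  have hg0 : 0 ≤ |g 0| + (L : ℝ) := add_nonneg (abs_nonneg _) L.2
  set p : (Fin d → ℝ) → ℝ := fun x => lineDeriv ℝ g x u with hp
  have hpm : Measurable p := measurable_lineDeriv hL.continuous
  have hpC : 0 ≤ (L : ℝ) * ‖u‖ := by positivity
  have hpb : ∀ x, |p x| ≤ (L * ‖u‖) * (1 + ‖x‖) := by
    intro x
    have h1 : ‖p x‖ ≤ L * ‖u‖ := norm_lineDeriv_le_of_lipschitz ℝ hL
    rw [Real.norm_eq_abs] at h1
    nlinarith [mul_nonneg hpC (norm_nonneg x)]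
  -- Gaussian quantities
  set φ := gaussPdf d μ S with hφ
  have hφc : Continuous φ := gauss_cont d μ S
  have hφn : ∀ x, 0 ≤ φ x := gauss_nonneg d μ S
  have hlin : ∀ w : Fin d → ℝ, ∃ M : ℝ, 0 ≤ M ∧
      ∀ x : Fin d → ℝ, |w ⬝ᵥ S⁻¹.mulVec (x - μ)| ≤ M * (1 + ‖x‖) := by
    intro w
    obtain ⟨M, hM, h⟩ := lin_bound w S⁻¹
    refine ⟨M * (1 + ‖μ‖), by positivity, fun x => (h _).trans ?_⟩
    rw [mul_assoc]
    gcongr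
    have := norm_sub_le x μ
    nlinarith [norm_nonneg x, norm_nonneg μ, mul_nonneg (norm_nonneg x) (norm_nonneg μ)]
  have hφB : GaussBdd d φ := by
    have := gauss_poly_bdd d μ S hS (fun _ => 1) 1 zero_le_one
      (fun x => by rw [abs_one]; nlinarith [norm_nonneg x])
    simpa using this
  have hψB : ∀ w : Fin d → ℝ, GaussBdd d (fun x => -(w ⬝ᵥ S⁻¹.mulVec (x - μ)) * φ x) := by
    intro w
    obtain ⟨M, hM, h⟩ := hlin w
    refine gauss_poly_bdd d μ S hS _ M hM fun x => ?_
    rw [abs_neg]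
    refine (h x).trans ?_
    gcongr
    nlinarith [norm_nonneg x]
  have hψB2 : GaussBdd d (fun x => (-(u ⬝ᵥ S⁻¹.mulVec (-u)) +
      (u ⬝ᵥ S⁻¹.mulVec (x - μ)) * ((-u) ⬝ᵥ S⁻¹.mulVec (x - μ))) * φ x) := by
    obtain ⟨M, hM, h⟩ := hlin u
    obtain ⟨M', hM', h'⟩ := hlin (-u)
    refine gauss_poly_bdd d μ S hS _ (|u ⬝ᵥ S⁻¹.mulVec (-u)| + M * M') (by positivity) fun x => ?_
    refine (abs_add_le _ _).trans ?_
    rw [abs_neg, abs_mul, add_mul]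
    refine add_le_add ?_ ?_
    · refine le_mul_of_one_le_right (abs_nonneg _) ?_
      nlinarith [norm_nonneg x]
    · calc _ ≤ (M * (1 + ‖x‖)) * (M' * (1 + ‖x‖)) :=
            mul_le_mul (h x) (h' x) (abs_nonneg _) (by positivity)
        _ = _ := by ring
  set ψ : (Fin d → ℝ) → ℝ := fun x => -(u ⬝ᵥ S⁻¹.mulVec (x - μ)) * φ x with hψ
  have hψc : Continuous ψ := by fun_prop
  have hψi : Integrable ψ := by
    have h0 := (hψB u).integrable_mul hψc (measurable_const (a := (1:ℝ))) 1 zero_le_one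
      (fun x => by simp) 0
    simp only [one_mul, add_zero] at h0
    exact h0
  -- integration by parts
  have hibp : ∫ x, p x * ψ x = ∫ x, g x * ((-(u ⬝ᵥ S⁻¹.mulVec (-u)) +
      (u ⬝ᵥ S⁻¹.mulVec (x - μ)) * ((-u) ⬝ᵥ S⁻¹.mulVec (x - μ))) * φ x) := by
    have h1 := hL.integral_inv_smul_sub_mul_tendsto_integral_lineDeriv_mul hψi u
    have h2 := tendsto_quot hψB2 hψc (fun x => gauss_deriv2 d μ S hS u (-u) x) hgm _ hg0 hgb
    refine tendsto_nhds_unique h1 (h2.congr fun t => ?_)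
    simpa only [smul_eq_mul] using (transl_quot (hψB u) hψc hgm _ hg0 hgb t).2.symm
  have hR : ∫ x, g x * ((u ⬝ᵥ S⁻¹.mulVec (x - μ)) ^ 2 - u ⬝ᵥ S⁻¹.mulVec u) * φ x =
      - ∫ x, p x * ψ x := by
    rw [hibp, ← integral_neg]
    congr 1
    ext x
    rw [mulVec_neg, dotProduct_neg, neg_dotProduct]
    ring
  have hlim : Tendsto (fun t : ℝ => ∫ x, (t⁻¹ * (p (x + t • u) - p x)) * φ x) (𝓝[>] 0)
      (𝓝 (- ∫ x, p x * ψ x)) := by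
    have h2 := tendsto_quot (hψB (-u)) hφc (fun x => gauss_deriv d μ S hS (-u) x) hpm _ hpC hpb
    have h3 : ∫ x, p x * (-((-u) ⬝ᵥ S⁻¹.mulVec (x - μ)) * φ x) = - ∫ x, p x * ψ x := by
      rw [← integral_neg]
      congr 1
      ext x
      rw [neg_dotProduct, hψ]
      ring
    rw [h3] at h2
    exact h2.congr fun t => (transl_quot hφB hφc hpm _ hpC hpb t).2.symm
  -- the sequence
  let τ : ℕ → ℝ := fun n => 1 / ((n : ℝ) + 1)
  have hτ0 : ∀ n, 0 < τ n := fun n => by positivity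
  have hτ : Tendsto τ atTop (𝓝[>] 0) :=
    tendsto_nhdsWithin_iff.2 ⟨tendsto_one_div_add_atTop_nhds_zero_nat,
      Eventually.of_forall hτ0⟩
  have had := hL.ae_differentiableAt (μ := (volume : Measure (Fin d → ℝ)))
  have had2 : ∀ᵐ x ∂(volume : Measure (Fin d → ℝ)), ∀ n, DifferentiableAt ℝ g (x + τ n • u) := by
    rw [ae_all_iff]
    intro n
    exact (measurePreserving_add_right volume (τ n • u)).quasiMeasurePreserving.ae had
  let q : ℕ → (Fin d → ℝ) → ℝ := fun n x => ((τ n)⁻¹ * (p (x + τ n • u) - p x)) * φ x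
  have hqm : ∀ n, Measurable (q n) := fun n =>
    (((hpm.comp (measurable_id.add_const _)).sub hpm).const_mul _).mul hφc.measurable
  have hqn : ∀ n, 0 ≤ᵐ[volume] q n := by
    intro n
    filter_upwards [had, had2] with x h1 h2
    have := mono_quot hconv x u (τ n) (hτ0 n) h1.lineDifferentiableAt
      (h2 n).lineDifferentiableAt
    have h3 : 0 ≤ p (x + τ n • u) - p x := sub_nonneg.2 this
    exact mul_nonneg (mul_nonneg (inv_nonneg.2 (hτ0 n).le) h3) (hφn x)
  have hqlim : ∀ᵐ x ∂(volume : Measure (Fin d → ℝ)),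
      Tendsto (fun n => q n x) atTop (𝓝 ((u ⬝ᵥ (H x).mulVec u) * φ x)) := by
    filter_upwards [had, had2, hH] with x h1 h2 ⟨D, hD, hDH⟩
    refine Tendsto.mul_const _ ?_
    have h3 := (hD.hasLineDerivAt u).tendsto_slope_zero_right.comp hτ
    have h4 := ((ContinuousLinearMap.apply ℝ ℝ u).continuous.tendsto _).comp h3
    rw [← hDH]
    refine h4.congr fun n => ?_
    simp only [Function.comp, ContinuousLinearMap.apply_apply, _root_.smul_apply,
      _root_.sub_apply, smul_eq_mul, hp]
    rw [(h2 n).lineDeriv_eq_fderiv, h1.lineDeriv_eq_fderiv]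
  calc ∫⁻ x, ENNReal.ofReal ((u ⬝ᵥ (H x).mulVec u) * φ x)
      = ∫⁻ x, liminf (fun n => ENNReal.ofReal (q n x)) atTop := by
        refine lintegral_congr_ae ?_
        filter_upwards [hqlim] with x hx
        exact (ENNReal.tendsto_ofReal hx).liminf_eq.symm
    _ ≤ liminf (fun n => ∫⁻ x, ENNReal.ofReal (q n x)) atTop :=
        lintegral_liminf_le fun n => (hqm n).ennreal_ofReal
    _ = liminf (fun n => ENNReal.ofReal (∫ x, q n x)) atTop := by
        congr 1
        ext n
        exact (ofReal_integral_eq_lintegral_ofReal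
          (transl_quot hφB hφc hpm _ hpC hpb (τ n)).1 (hqn n)).symm
    _ = ENNReal.ofReal (- ∫ x, p x * ψ x) :=
        (ENNReal.tendsto_ofReal (hlim.comp hτ)).liminf_eq
    _ = _ := by rw [← hR]
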